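/- Fix ε with 6√(log n / n) < ε. If K ⊂ ℝⁿ is a convex body with γ_n(K) ≥ e^{−εn}, then for sufficiently large n the Gaussian mean-width satisfies w(K) ≥ (1 − 2√ε) n. -/

import Mathlib

open MeasureTheory Real
open scoped RealInnerProductSpace Pointwise

/-- The standard Gaussian measure on `ℝⁿ`. -/
noncomputable def gauss (n : ℕ) : Measure (EuclideanSpace ℝ (Fin n)) :=
  volume.withDensity (fun x => ENNReal.ofReal ((2 * π) ^ (-(n : ℝ) / 2) * Real.exp (-‖x‖ ^ 2 / 2)))

/-- The Gaussian mean-width `w(K) = E[sup_{x ∈ K} ⟨Γ, x⟩]` of a set `K ⊆ ℝⁿ`. -/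
noncomputable def meanWidth (n : ℕ) (K : Set (EuclideanSpace ℝ (Fin n))) : ℝ :=
  ∫ g, sSup ((fun x => ⟪g, x⟫) '' K) ∂(gauss n)

open scoped ENNReal


lemma bm_compact {A B : Set ℝ} (hA : IsCompact A) (hB : IsCompact B) (hAn : A.Nonempty)
    (hBn : B.Nonempty) : volume A + volume B ≤ volume (A + B) := by
  set a := sSup A with ha
  set b := sInf B with hb
  have haA : a ∈ A := hA.sSup_mem hAn
  have hbB : b ∈ B := hB.sInf_mem hBn
  have h1 : volume ((fun x => b + x) '' A) = volume A := by
    rw [Set.image_add_left]; simp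
  have h2 : volume ((fun x => a + x) '' B) = volume B := by
    rw [Set.image_add_left]; simp
  rw [← h1, ← h2]
  have hm : MeasurableSet ((fun x => a + x) '' B) :=
    (hB.image (by fun_prop)).isClosed.measurableSet
  have hd : AEDisjoint volume ((fun x => b + x) '' A) ((fun x => a + x) '' B) := by
    refine measure_mono_null (t := {a + b}) ?_ (by simp)
    rintro z ⟨⟨x, hx, rfl⟩, ⟨y, hy, hxy⟩⟩
    have h3 : x ≤ a := le_csSup hA.bddAbove hx
    have h4 : b ≤ y := csInf_le hB.bddBelow hy
    simp only [Set.mem_singleton_iff] at *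
    linarith
  rw [← measure_union₀ hm.nullMeasurableSet hd]
  refine measure_mono (Set.union_subset ?_ ?_)
  · rintro z ⟨x, hx, rfl⟩
    exact Set.mem_add.2 ⟨x, hx, b, hbB, add_comm _ _⟩
  · rintro z ⟨x, hx, rfl⟩
    exact Set.mem_add.2 ⟨a, haA, x, hx, rfl⟩

lemma bm_meas {A B : Set ℝ} (hA : MeasurableSet A) (hB : MeasurableSet B) (hAn : A.Nonempty)
    (hBn : B.Nonempty) : volume A + volume B ≤ volume (A + B) := by
  obtain ⟨a, ha⟩ := hAn
  obtain ⟨b, hb⟩ := hBn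
  rw [hA.measure_eq_iSup_isCompact, hB.measure_eq_iSup_isCompact]
  simp only [iSup_and']
  refine ENNReal.biSup_add_biSup_le' (p := fun K => K ⊆ A ∧ IsCompact K)
    (q := fun K => K ⊆ B ∧ IsCompact K)
    ⟨∅, by simp⟩ ⟨∅, by simp⟩ ?_
  intro K hK L hL
  calc volume K + volume L ≤ volume (insert a K) + volume (insert b L) := by
        gcongr <;> simp
    _ ≤ volume (insert a K + insert b L) :=
        bm_compact (hK.2.insert a) (hL.2.insert b) ⟨a, by simp⟩ ⟨b, by simp⟩
    _ ≤ volume (A + B) := by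
        apply measure_mono
        apply Set.add_subset_add
        · exact Set.insert_subset ha hK.1
        · exact Set.insert_subset hb hL.1

lemma layer {f : ℝ → ℝ≥0∞} (hf : Measurable f) (h1 : ∀ x, f x ≤ 1) :
    ∫⁻ x, f x = ∫⁻ t in Set.Ioi (0:ℝ), volume {x | ENNReal.ofReal t < f x} := by
  have h0 : ∀ x, f x ≠ ⊤ := fun x => ((h1 x).trans_lt ENNReal.one_lt_top).ne
  have := lintegral_eq_lintegral_meas_lt (volume : Measure ℝ) (f := fun x => (f x).toReal)
    (Filter.Eventually.of_forall fun x => ENNReal.toReal_nonneg) hf.ennreal_toReal.aemeasurable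
  simp only [ENNReal.ofReal_toReal (h0 _)] at this
  rw [this]
  refine setLIntegral_congr_fun measurableSet_Ioi fun t ht => ?_
  congr 1; ext x
  simp only [Set.mem_ofPred_eq]
  rw [ENNReal.ofReal_lt_iff_lt_toReal (le_of_lt ht) (h0 x)]

lemma pl1_norm {f g h : ℝ → ℝ≥0∞} (hf : Measurable f) (hg : Measurable g) (hh : Measurable h)
    (hf1 : ⨆ x, f x = 1) (hg1 : ⨆ x, g x = 1)
    (H : ∀ x y, f x * g y ≤ h ((x + y) / 2) ^ 2) :
    (∫⁻ x, f x) + ∫⁻ x, g x ≤ 2 * ∫⁻ x, h x := by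
  have hf2 : ∀ x, f x ≤ 1 := fun x => hf1 ▸ le_iSup f x
  have hg2 : ∀ x, g x ≤ 1 := fun x => hg1 ▸ le_iSup g x
  have hmono : ∫⁻ x, min (h x) 1 ≤ ∫⁻ x, h x := lintegral_mono fun x => min_le_left _ _
  refine le_trans ?_ (mul_le_mul_right hmono 2)
  rw [layer hf hf2, layer hg hg2, layer (hh.min measurable_const) (fun x => min_le_right _ _),
    ← lintegral_const_mul' _ _ (by simp)]
  rw [← lintegral_add_left]
  swap
  · have : Antitone fun t : ℝ => volume {x | ENNReal.ofReal t < f x} := by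
      intro s t hst
      apply measure_mono
      intro x hx
      exact (ENNReal.ofReal_le_ofReal hst).trans_lt hx
    exact this.measurable
  refine setLIntegral_mono' measurableSet_Ioi fun t ht => ?_
  rcases lt_or_ge t 1 with h1 | h1
  · have ht1 : ENNReal.ofReal t < 1 := by simpa using h1
    have hA : {x | ENNReal.ofReal t < f x}.Nonempty := by
      obtain ⟨x, hx⟩ := lt_iSup_iff.1 (hf1.symm ▸ ht1)
      exact ⟨x, hx⟩
    have hB : {x | ENNReal.ofReal t < g x}.Nonempty := by
      obtain ⟨x, hx⟩ := lt_iSup_iff.1 (hg1.symm ▸ ht1)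
      exact ⟨x, hx⟩
    refine (bm_meas (measurableSet_lt measurable_const hf) (measurableSet_lt measurable_const hg)
      hA hB).trans ?_
    have : volume ((2:ℝ) • {x | ENNReal.ofReal t < min (h x) 1}) =
        2 * volume {x | ENNReal.ofReal t < min (h x) 1} := by
      rw [Measure.addHaar_smul]; simp
    rw [← this]
    apply measure_mono
    intro z hz
    obtain ⟨x, hx, y, hy, rfl⟩ := Set.mem_add.1 hz
    refine Set.mem_smul_set.2 ⟨(x + y) / 2, ?_, by simp; ring⟩
    simp only [Set.mem_ofPred_eq, lt_min_iff] at *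
    refine ⟨?_, by simpa using h1⟩
    by_contra hcon
    push Not at hcon
    have h3 := H x y
    have h4 : ENNReal.ofReal t * ENNReal.ofReal t < f x * g y := ENNReal.mul_lt_mul hx hy
    have h5 : h ((x+y)/2)^2 ≤ ENNReal.ofReal t ^ 2 := by gcongr
    rw [sq (ENNReal.ofReal t)] at h5
    exact absurd (h4.trans_le (h3.trans h5)) (lt_irrefl _)
  · have ht1 : 1 ≤ ENNReal.ofReal t := by simpa using h1
    have e1 : {x | ENNReal.ofReal t < f x} = ∅ := by
      ext x; simpa using (hf2 x).trans ht1
    have e2 : {x | ENNReal.ofReal t < g x} = ∅ := by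
      ext x; simpa using (hg2 x).trans ht1
    simp [e1, e2]

lemma amgm {S T U : ℝ≥0∞} (h : S + T ≤ 2 * U) : S * T ≤ U ^ 2 := by
  by_cases hU : U = ⊤
  · simp [hU]
  have hlt : 2 * U < ⊤ := ENNReal.mul_lt_top (by simp) (lt_top_iff_ne_top.2 hU)
  have hS : S ≠ ⊤ := ((le_self_add).trans_lt (h.trans_lt hlt)).ne
  have hT : T ≠ ⊤ := ((le_add_self).trans_lt (h.trans_lt hlt)).ne
  lift S to NNReal using hS
  lift T to NNReal using hT
  lift U to NNReal using hU
  norm_cast at *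
  have h' : (S:ℝ) + T ≤ 2 * U := by exact_mod_cast h
  have : (S:ℝ) * T ≤ U^2 := by nlinarith [sq_nonneg ((S:ℝ) - T), S.2, T.2, U.2]
  exact_mod_cast this

lemma pl1_bdd {f g h : ℝ → ℝ≥0∞} (hf : Measurable f) (hg : Measurable g) (hh : Measurable h)
    (m : ℝ≥0∞) (hm : m ≠ ⊤) (hf1 : ∀ x, f x ≤ m) (hg1 : ∀ x, g x ≤ m)
    (H : ∀ x y, f x * g y ≤ h ((x + y) / 2) ^ 2) :
    (∫⁻ x, f x) * ∫⁻ x, g x ≤ (∫⁻ x, h x) ^ 2 := by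
  set a := ⨆ x, f x with ha
  set b := ⨆ x, g x with hb
  have haT : a ≠ ⊤ := ne_top_of_le_ne_top hm (iSup_le hf1)
  have hbT : b ≠ ⊤ := ne_top_of_le_ne_top hm (iSup_le hg1)
  by_cases ha0 : a = 0
  · have : ∀ x, f x = 0 := fun x => le_antisymm (ha0 ▸ le_iSup f x) zero_le
    simp [this]
  by_cases hb0 : b = 0
  · have : ∀ x, g x = 0 := fun x => le_antisymm (hb0 ▸ le_iSup g x) zero_le
    simp [this]
  set c := (a * b) ^ (1/2 : ℝ) with hc
  have hc2 : c ^ 2 = a * b := by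
    rw [hc, ← ENNReal.rpow_natCast, ← ENNReal.rpow_mul]; norm_num
  have hcT : c ≠ ⊤ := by
    intro h0; rw [h0] at hc2; simp at hc2; exact ENNReal.mul_ne_top haT hbT hc2.symm
  have hc0 : c ≠ 0 := by
    intro h0; rw [h0] at hc2; simp at hc2; tauto
  have key := pl1_norm (f := fun x => a⁻¹ * f x) (g := fun x => b⁻¹ * g x)
    (h := fun x => c⁻¹ * h x) (by fun_prop) (by fun_prop) (by fun_prop)
    (by rw [← ENNReal.mul_iSup, ← ha, ENNReal.inv_mul_cancel ha0 haT])
    (by rw [← ENNReal.mul_iSup, ← hb, ENNReal.inv_mul_cancel hb0 hbT])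
    (by
      intro x y
      rw [mul_pow, ← ENNReal.inv_pow, hc2, ENNReal.mul_inv (Or.inl ha0) (Or.inl haT)]
      calc _ = a⁻¹ * b⁻¹ * (f x * g y) := by ring
        _ ≤ _ := by gcongr; exact H x y)
  have k2 := amgm key
  rw [lintegral_const_mul _ hf, lintegral_const_mul _ hg, lintegral_const_mul _ hh] at k2
  calc (∫⁻ x, f x) * ∫⁻ x, g x
      = (a * b) * (a⁻¹ * (∫⁻ x, f x) * (b⁻¹ * ∫⁻ x, g x)) := by
        calc _ = (a * a⁻¹) * (b * b⁻¹) * ((∫⁻ x, f x) * ∫⁻ x, g x) := by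
              rw [ENNReal.mul_inv_cancel ha0 haT, ENNReal.mul_inv_cancel hb0 hbT]; simp
          _ = _ := by ring
    _ ≤ (a * b) * (c⁻¹ * ∫⁻ x, h x) ^ 2 := by gcongr
    _ = (c * c⁻¹) ^ 2 * (∫⁻ x, h x) ^ 2 := by rw [← hc2]; ring
    _ = _ := by rw [ENNReal.mul_inv_cancel hc0 hcT]; simp

lemma lint_trunc {f : ℝ → ℝ≥0∞} (hf : Measurable f) :
    ∫⁻ x, f x = ⨆ m : ℕ, ∫⁻ x, min (f x) m := by
  rw [← lintegral_iSup (fun m => hf.min measurable_const)]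
  · congr 1; ext x
    apply le_antisymm
    · by_cases hx : f x = ⊤
      · simp [hx, ENNReal.iSup_natCast]
      · obtain ⟨m, hm⟩ := ENNReal.exists_nat_gt hx
        refine le_iSup_of_le m ?_
        simp [hm.le]
    · exact iSup_le fun m => min_le_left _ _
  · intro i j hij x
    exact min_le_min le_rfl (by exact_mod_cast hij)

lemma pl1 {f g h : ℝ → ℝ≥0∞} (hf : Measurable f) (hg : Measurable g) (hh : Measurable h)
    (H : ∀ x y, f x * g y ≤ h ((x + y) / 2) ^ 2) :
    (∫⁻ x, f x) * ∫⁻ x, g x ≤ (∫⁻ x, h x) ^ 2 := by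
  rw [lint_trunc hf, lint_trunc hg]
  rw [ENNReal.iSup_mul]
  refine iSup_le fun i => ?_
  rw [ENNReal.mul_iSup]
  refine iSup_le fun j => ?_
  refine pl1_bdd (hf.min measurable_const) (hg.min measurable_const) hh (max i j) (by simp)
    (fun x => (min_le_right _ _).trans (le_max_left _ _))
    (fun x => (min_le_right _ _).trans (le_max_right _ _)) fun x y => ?_
  exact (mul_le_mul' (min_le_left _ _) (min_le_left _ _)).trans (H x y)

lemma lint_cons {n : ℕ} {f : (Fin (n+1) → ℝ) → ℝ≥0∞} (hf : Measurable f) :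
    ∫⁻ x, f x = ∫⁻ s : ℝ, ∫⁻ x : Fin n → ℝ, f (Fin.cons s x) := by
  have e := (volume_preserving_piFinSuccAbove (fun _ : Fin (n + 1) => ℝ) 0).symm
  rw [← e.lintegral_comp hf, Measure.volume_eq_prod, lintegral_prod]
  · simp [MeasurableEquiv.piFinSuccAbove, Fin.insertNthEquiv]
  · exact (hf.comp e.measurable).aemeasurable

lemma meas_cons {n : ℕ} : Measurable fun p : ℝ × (Fin n → ℝ) => (Fin.cons p.1 p.2 : Fin (n+1) → ℝ) := by
  rw [measurable_pi_iff]
  intro i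
  refine Fin.cases ?_ (fun i => ?_) i
  · simp; fun_prop
  · simp; fun_prop

lemma pln (n : ℕ) : ∀ {f g h : (Fin n → ℝ) → ℝ≥0∞}, Measurable f → Measurable g → Measurable h →
    (∀ x y, f x * g y ≤ h (fun i => (x i + y i) / 2) ^ 2) →
    (∫⁻ x, f x) * ∫⁻ x, g x ≤ (∫⁻ x, h x) ^ 2 := by
  induction n with
  | zero =>
    intro f g h hf hg hh H
    rw [Measure.volume_pi_eq_dirac 0, lintegral_dirac, lintegral_dirac, lintegral_dirac]
    convert H 0 0 using 3
  | succ n ih =>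
    intro f g h hf hg hh H
    rw [lint_cons hf, lint_cons hg, lint_cons hh]
    have hf' := hf.comp (meas_cons (n := n))
    have hg' := hg.comp (meas_cons (n := n))
    have hh' := hh.comp (meas_cons (n := n))
    refine pl1 hf'.lintegral_prod_right' hg'.lintegral_prod_right' hh'.lintegral_prod_right' ?_
    intro s t
    refine ih (hf'.comp measurable_prodMk_left) (hg'.comp measurable_prodMk_left)
      (hh'.comp measurable_prodMk_left) ?_
    intro x y
    convert H (Fin.cons s x) (Fin.cons t y) using 3
    ext i
    refine Fin.cases ?_ (fun i => ?_) i <;> simp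

lemma meas_dens (n : ℕ) : Measurable (fun x : EuclideanSpace ℝ (Fin n) =>
    ENNReal.ofReal ((2 * π) ^ (-(n : ℝ) / 2) * Real.exp (-‖x‖ ^ 2 / 2))) := by fun_prop

lemma gauss_univ (n : ℕ) : gauss n Set.univ = 1 := by
  have hI := GaussianFourier.integral_rexp_neg_mul_sq_norm (V := EuclideanSpace ℝ (Fin n))
    (b := 1/2) (by norm_num)
  have hI2 : ∫ x : EuclideanSpace ℝ (Fin n), (2 * π) ^ (-(n : ℝ) / 2) * Real.exp (-‖x‖ ^ 2 / 2)
      = 1 := by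
    rw [integral_const_mul]
    have : ∀ x : EuclideanSpace ℝ (Fin n), -‖x‖ ^ 2 / 2 = -(1/2) * ‖x‖^2 := fun x => by ring
    simp_rw [this]
    rw [hI, finrank_euclideanSpace_fin, show π / (1/2) = 2 * π by ring,
      ← Real.rpow_add (by positivity)]
    simp [neg_div]
  rw [gauss, withDensity_apply _ MeasurableSet.univ, setLIntegral_univ,
    ← ofReal_integral_eq_lintegral_ofReal, hI2]
  · simp
  · by_contra h
    rw [integral_undef h] at hI2
    norm_num at hI2
  · exact Filter.Eventually.of_forall fun x => by positivity

instance gauss_prob (n : ℕ) : IsProbabilityMeasure (gauss n) := ⟨gauss_univ n⟩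

lemma gauss_eq (n : ℕ) : gauss n = ProbabilityTheory.stdGaussian (EuclideanSpace ℝ (Fin n)) := by
  apply Measure.ext_of_charFun
  ext t
  rw [ProbabilityTheory.charFun_stdGaussian, charFun_apply, gauss,
    integral_withDensity_eq_integral_toReal_smul (meas_dens n)
      (Filter.Eventually.of_forall fun x => ENNReal.ofReal_lt_top)]
  have h := GaussianFourier.integral_cexp_neg_mul_sq_norm_add (V := EuclideanSpace ℝ (Fin n))
    (b := 1/2) (by norm_num) Complex.I t
  have e : ∀ x : EuclideanSpace ℝ (Fin n),
      (ENNReal.ofReal ((2 * π) ^ (-(n : ℝ) / 2) * Real.exp (-‖x‖ ^ 2 / 2))).toReal •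
        Complex.exp (⟪x, t⟫ * Complex.I) = (((2 * π) ^ (-(n : ℝ) / 2) : ℝ) : ℂ) *
        Complex.exp (-(1/2) * ‖x‖^2 + Complex.I * ⟪t, x⟫) := by
    intro x
    rw [ENNReal.toReal_ofReal (by positivity), Complex.exp_add, real_inner_comm,
      Complex.real_smul]
    push_cast
    rw [mul_assoc]
    congr 2
    · congr 1; ring
    · rw [mul_comm]
  simp_rw [e]
  rw [integral_const_mul, h, finrank_euclideanSpace_fin]
  have e2 : ((π:ℂ) / (1/2)) ^ ((n:ℂ)/2) = (((2 * π) ^ ((n : ℝ) / 2) : ℝ) : ℂ) := by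
    rw [Complex.ofReal_cpow (by positivity)]
    push_cast
    congr 1; ring
  rw [e2, ← mul_assoc, ← Complex.ofReal_mul, ← Real.rpow_add (by positivity)]
  simp [neg_div]
  congr 1; ring

lemma gauss_sq (n : ℕ) : Integrable (fun x => ‖x‖^2) (gauss n) ∧ ∫ x, ‖x‖^2 ∂(gauss n) = n := by
  rw [gauss_eq]
  have hI : ∀ i : Fin n, Integrable (fun x : EuclideanSpace ℝ (Fin n) => x i ^ 2)
      (ProbabilityTheory.stdGaussian (EuclideanSpace ℝ (Fin n))) := fun i =>
    (ProbabilityTheory.IsGaussian.memLp_dual _ (EuclideanSpace.proj i) 2 (by simp)).integrable_sq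
  have hE : ∀ i : Fin n, ∫ x, (x i)^2
      ∂(ProbabilityTheory.stdGaussian (EuclideanSpace ℝ (Fin n))) = 1 := by
    intro i
    let L := innerSL ℝ (EuclideanSpace.single i (1:ℝ))
    have h := ProbabilityTheory.variance_dual_stdGaussian L
    rw [ProbabilityTheory.variance_of_integral_eq_zero (by fun_prop)
      (ProbabilityTheory.integral_strongDual_stdGaussian _)] at h
    simpa [L, EuclideanSpace.inner_single_left] using h
  simp_rw [EuclideanSpace.real_norm_sq_eq]
  refine ⟨integrable_finsetSum _ fun i _ => hI i, ?_⟩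
  rw [integral_finsetSum _ fun i _ => hI i]
  simp [hE]

lemma maurey (n : ℕ) {K : Set (EuclideanSpace ℝ (Fin n))} (hK : IsCompact K) :
    (∫⁻ x, ENNReal.ofReal (Real.exp (Metric.infDist x K ^ 2 / 4)) ∂(gauss n)) * gauss n K ≤ 1 := by
  set p : EuclideanSpace ℝ (Fin n) → ℝ≥0∞ := fun x =>
    ENNReal.ofReal ((2 * π) ^ (-(n : ℝ) / 2) * Real.exp (-‖x‖ ^ 2 / 2)) with hp
  have hpm : Measurable p := meas_dens n
  have hd : Measurable fun x => ENNReal.ofReal (Real.exp (Metric.infDist x K ^ 2 / 4)) := by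
    have := (Metric.continuous_infDist_pt K).measurable
    fun_prop
  have hKm : MeasurableSet K := hK.isClosed.measurableSet
  have e1 : gauss n K = ∫⁻ x, K.indicator p x := by
    rw [gauss, withDensity_apply _ hKm, lintegral_indicator hKm]
  have e2 : ∫⁻ x, p x = 1 := by
    rw [← gauss_univ n, gauss, withDensity_apply _ MeasurableSet.univ, setLIntegral_univ]
  rw [e1, gauss, lintegral_withDensity_eq_lintegral_mul _ hpm hd]
  have V := PiLp.volume_preserving_toLp (Fin n)
  have hf : Measurable (p * fun x => ENNReal.ofReal (Real.exp (Metric.infDist x K ^ 2 / 4))) :=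
    hpm.mul hd
  have hg := hpm.indicator hKm
  rw [← V.lintegral_comp hpm] at e2
  rw [← V.lintegral_comp hf, ← V.lintegral_comp hg]
  refine le_trans ?_ (show (∫⁻ a : Fin n → ℝ, p (WithLp.toLp 2 a)) ^ 2 ≤ 1 by rw [e2, one_pow])
  refine pln n (hf.comp V.measurable) (hg.comp V.measurable) (hpm.comp V.measurable) ?_
  intro x' y'
  have em : (WithLp.toLp 2 fun i => (x' i + y' i) / 2) =
      (1/2 : ℝ) • (WithLp.toLp 2 x' + WithLp.toLp 2 y' : EuclideanSpace ℝ (Fin n)) := by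
    ext i; simp; ring
  rw [em]
  generalize (WithLp.toLp 2 x' : EuclideanSpace ℝ (Fin n)) = x
  generalize (WithLp.toLp 2 y' : EuclideanSpace ℝ (Fin n)) = y
  by_cases hy : y ∈ K
  swap
  · simp [hy]
  rw [Set.indicator_of_mem hy]
  simp only [hp, Pi.mul_apply]
  rw [← ENNReal.ofReal_mul (by positivity), ← ENNReal.ofReal_mul (by positivity),
    ← ENNReal.ofReal_pow (by positivity)]
  apply ENNReal.ofReal_le_ofReal
  set c : ℝ := (2 * π) ^ (-(n : ℝ) / 2)
  have hdle : Metric.infDist x K ≤ ‖x - y‖ := by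
    rw [← dist_eq_norm]; exact Metric.infDist_le_dist_of_mem hy
  have hd0 : 0 ≤ Metric.infDist x K := Metric.infDist_nonneg
  have par := parallelogram_law_with_norm ℝ x y
  have hm : ‖(1/2:ℝ) • (x + y)‖ = ‖x + y‖ / 2 := by
    rw [norm_smul]; norm_num; ring
  calc _ = c^2 * Real.exp (-‖x‖ ^ 2 / 2 + Metric.infDist x K ^ 2 / 4 + -‖y‖ ^ 2 / 2) := by
        rw [Real.exp_add, Real.exp_add]; ring
    _ ≤ c^2 * Real.exp (-‖(1/2:ℝ) • (x + y)‖ ^ 2 / 2 + -‖(1/2:ℝ) • (x + y)‖ ^ 2 / 2) := by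
        gcongr c^2 * Real.exp ?_
        rw [hm]
        nlinarith
    _ = _ := by rw [Real.exp_add]; ring

lemma main_bound (n : ℕ) {ε : ℝ} (hε : 0 < ε) {K : Set (EuclideanSpace ℝ (Fin n))}
    (hK : IsCompact K) (hne : K.Nonempty)
    (h : ENNReal.ofReal (Real.exp (-ε * n)) ≤ gauss n K) :
    (1 - 2 * Real.sqrt ε) * n ≤ meanWidth n K := by
  obtain ⟨hI2, hE2⟩ := gauss_sq n
  set d : EuclideanSpace ℝ (Fin n) → ℝ := fun x => Metric.infDist x K with hdd
  have hdc : Continuous d := Metric.continuous_infDist_pt K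
  have hM := maurey n hK
  -- exponential moment bound
  have hM2 : (∫⁻ x, ENNReal.ofReal (Real.exp (d x ^ 2 / 4)) ∂(gauss n)) ≤
      ENNReal.ofReal (Real.exp (ε * n)) := by
    have h1 : (∫⁻ x, ENNReal.ofReal (Real.exp (d x ^ 2 / 4)) ∂(gauss n)) *
        ENNReal.ofReal (Real.exp (-ε * n)) ≤ 1 := (mul_le_mul_right h _).trans hM
    calc _ = (∫⁻ x, ENNReal.ofReal (Real.exp (d x ^ 2 / 4)) ∂(gauss n)) *
        ENNReal.ofReal (Real.exp (-ε * n)) * ENNReal.ofReal (Real.exp (ε * n)) := by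
          rw [mul_assoc, ← ENNReal.ofReal_mul (by positivity), ← Real.exp_add]
          simp
      _ ≤ 1 * ENNReal.ofReal (Real.exp (ε * n)) := by gcongr
      _ = _ := one_mul _
  have hexpI : Integrable (fun x => Real.exp (d x ^ 2 / 4)) (gauss n) := by
    refine ⟨(by fun_prop : Continuous fun x => Real.exp (d x ^ 2 / 4)).aestronglyMeasurable, ?_⟩
    rw [hasFiniteIntegral_iff_ofReal (Filter.Eventually.of_forall fun x => by positivity)]
    exact hM2.trans_lt ENNReal.ofReal_lt_top
  have hexp : ∫ x, Real.exp (d x ^ 2 / 4) ∂(gauss n) ≤ Real.exp (ε * n) := by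
    rw [← ofReal_integral_eq_lintegral_ofReal hexpI
      (Filter.Eventually.of_forall fun x => by positivity)] at hM2
    exact (ENNReal.ofReal_le_ofReal_iff (by positivity)).1 hM2
  -- second moment of the distance
  have hdI : Integrable (fun x => d x ^ 2) (gauss n) := by
    refine (hexpI.const_mul 4).mono'
      (by fun_prop : Continuous fun x => d x ^ 2).aestronglyMeasurable
      (Filter.Eventually.of_forall fun x => ?_)
    rw [Real.norm_of_nonneg (by positivity)]
    linarith [Real.add_one_le_exp (d x ^ 2 / 4)]
  have hdE : ∫ x, d x ^ 2 ∂(gauss n) ≤ 4 * (ε * n) := by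
    have : ∫ x, d x ^ 2 ∂(gauss n) ≤
        ∫ x, (4 * (ε * n - 1) + 4 * Real.exp (-(ε * n)) * Real.exp (d x ^ 2 / 4)) ∂(gauss n) := by
      refine integral_mono hdI ((integrable_const _).add (hexpI.const_mul _)) fun x => ?_
      have := Real.add_one_le_exp (d x ^ 2 / 4 - ε * n)
      rw [sub_eq_neg_add, Real.exp_add] at this
      simp only
      linarith
    rw [integral_add (integrable_const _) (hexpI.const_mul _), integral_const, probReal_univ, one_smul,
      integral_const_mul] at this
    have h3 : Real.exp (-(ε * n)) * ∫ x, Real.exp (d x ^ 2 / 4) ∂(gauss n) ≤ 1 := by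
      calc _ ≤ Real.exp (-(ε * n)) * Real.exp (ε * n) := by gcongr
        _ = 1 := by rw [← Real.exp_add]; simp
    linarith
  -- the support function
  have hSc : Continuous fun g : EuclideanSpace ℝ (Fin n) => sSup ((fun x => ⟪g, x⟫) '' K) :=
    hK.continuous_sSup (f := fun g x : EuclideanSpace ℝ (Fin n) => ⟪g, x⟫) (by fun_prop)
  have hbdd : ∀ g : EuclideanSpace ℝ (Fin n), BddAbove ((fun x => ⟪g, x⟫) '' K) := fun g =>
    (hK.image (by fun_prop)).bddAbove
  have hSI : Integrable (fun g => sSup ((fun x => ⟪g, x⟫) '' K)) (gauss n) := by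
    obtain ⟨R, hR⟩ := hK.isBounded.exists_norm_le
    have hR0 : 0 ≤ R := (norm_nonneg _).trans (hR _ hne.some_mem)
    refine (((integrable_const (1:ℝ)).add hI2).const_mul R).mono' hSc.aestronglyMeasurable
      (Filter.Eventually.of_forall fun g => ?_)
    have hb : ∀ x ∈ K, |⟪g, x⟫| ≤ R * (1 + ‖g‖^2) := by
      intro x hx
      calc |⟪g, x⟫| ≤ ‖g‖ * ‖x‖ := abs_real_inner_le_norm _ _
        _ ≤ (1 + ‖g‖^2) * R := by
          gcongr
          · nlinarith [sq_nonneg (‖g‖ - 1)]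
          · exact hR x hx
        _ = _ := mul_comm _ _
    simp only [Real.norm_eq_abs, Pi.add_apply]
    rw [abs_le]
    constructor
    · obtain ⟨x, hx⟩ := hne
      exact (abs_le.1 (hb x hx)).1.trans (le_csSup (hbdd g) ⟨x, hx, rfl⟩)
    · refine csSup_le (hne.image _) ?_
      rintro _ ⟨x, hx, rfl⟩
      exact (abs_le.1 (hb x hx)).2
  set s := Real.sqrt ε with hs
  have hs0 : 0 < s := Real.sqrt_pos.2 hε
  have hss : s ^ 2 = ε := Real.sq_sqrt hε.le
  have hpt : ∀ g, (1 - s) * ‖g‖^2 - (4 * s)⁻¹ * d g ^ 2 ≤ sSup ((fun x => ⟪g, x⟫) '' K) := by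
    intro g
    obtain ⟨y, hy, hgy⟩ := hK.exists_infDist_eq_dist hne g
    refine le_trans ?_ (le_csSup (hbdd g) ⟨y, hy, rfl⟩)
    have h1 : ⟪g, y⟫ = ‖g‖^2 - ⟪g, g - y⟫ := by
      rw [inner_sub_right, real_inner_self_eq_norm_sq]; ring
    have h2 : ⟪g, g - y⟫ ≤ ‖g‖ * d g := by
      rw [hdd]; simp only; rw [hgy, dist_eq_norm]; exact real_inner_le_norm _ _
    have h3 : ‖g‖ * d g ≤ s * ‖g‖^2 + (4 * s)⁻¹ * d g ^ 2 := by
      have : s * ‖g‖^2 + (4 * s)⁻¹ * d g ^ 2 - ‖g‖ * d g = s * (‖g‖ - d g / (2 * s)) ^ 2 := by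
        field_simp; ring
      nlinarith [mul_nonneg hs0.le (sq_nonneg (‖g‖ - d g / (2 * s)))]
    simp only
    rw [h1]
    linarith
  have hfin := integral_mono ((hI2.const_mul (1 - s)).sub (hdI.const_mul (4 * s)⁻¹)) hSI hpt
  rw [meanWidth]
  refine le_trans ?_ hfin
  simp only [Pi.sub_apply]
  rw [integral_sub (hI2.const_mul (1 - s)) (hdI.const_mul (4 * s)⁻¹), integral_const_mul,
    integral_const_mul, hE2]
  have : (4 * s)⁻¹ * ∫ x, d x ^ 2 ∂(gauss n) ≤ s * n := by
    calc _ ≤ (4 * s)⁻¹ * (4 * (ε * n)) := by gcongr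
      _ = s * n := by rw [← hss]; field_simp
  linarith

theorem stmt6 (ε : ℝ) (hε : 0 < ε) :
    ∃ N : ℕ, ∀ n ≥ N, 6 * Real.sqrt (Real.log n / n) < ε →
      ∀ K : Set (EuclideanSpace ℝ (Fin n)), Convex ℝ K → IsCompact K → K.Nonempty →
        ENNReal.ofReal (Real.exp (-ε * n)) ≤ gauss n K →
        (1 - 2 * Real.sqrt ε) * n ≤ meanWidth n K :=
  ⟨0, fun n _ _ _ _ hK hne h => main_bound n hε hK hne h⟩
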